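/- (Convergence rate of the orthogonal greedy algorithm.) Let H be a complex Hilbert space and D a set of unit vectors in H. Suppose f ∈ H admits a representation f = Σ_{j=1}^{∞} c_j·g_j converging in H with g_j ∈ D and Σ_{j=1}^{∞} |c_j| ≤ M. Let (e_k)_{k≥1} be a sequence in D chosen greedily: for each k ≥ 1, writing P_{k−1} for the orthogonal projection onto the span of {e_1, …, e_{k−1}} (with P_0 = 0) and h_k = f − P_{k−1} f, the selection satisfies |⟨h_k, e_k⟩| = sup{ |⟨h_k, g⟩| : g ∈ D }. Then for every m ≥ 1, ‖f − P_m f‖ ≤ M·m^{−1/2}. -/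

import Mathlib

open scoped InnerProductSpace

/-- Subtracting from `h` its component along a unit vector `e` and then projecting further
decreases the squared norm by at least `‖⟪h, e⟫‖ ^ 2`. -/
theorem norm_sq_le_sub_norm_inner_sq {𝕜 E : Type*} [RCLike 𝕜] [NormedAddCommGroup E]
    [InnerProductSpace 𝕜 E] {h h' e : E} (he : ‖e‖ = 1)
    (horth : ⟪h - h', h'⟫_𝕜 = 0) (horth_e : ⟪e, h'⟫_𝕜 = 0) :
    ‖h'‖ ^ 2 ≤ ‖h‖ ^ 2 - ‖⟪h, e⟫_𝕜‖ ^ 2 := by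
  have hpyth : ‖h‖ ^ 2 = ‖h - h'‖ ^ 2 + ‖h'‖ ^ 2 := by
    simpa [sq] using norm_add_sq_eq_norm_sq_add_norm_sq_of_inner_eq_zero (h - h') h' horth
  have hinner : ⟪h, e⟫_𝕜 = ⟪h - h', e⟫_𝕜 := by
    rw [inner_sub_left, inner_eq_zero_symm.mp horth_e, sub_zero]
  have hle : ‖⟪h, e⟫_𝕜‖ ≤ ‖h - h'‖ := by
    simpa [hinner, he] using norm_inner_le_norm (𝕜 := 𝕜) (h - h') e
  have := pow_le_pow_left₀ (norm_nonneg _) hle 2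
  linarith

/-- The pairing with an absolutely convergent combination of the `g j` is controlled by a uniform
bound on the pairings with the `g j`. -/
theorem norm_inner_le_of_hasSum {𝕜 E ι : Type*} [RCLike 𝕜] [NormedAddCommGroup E]
    [InnerProductSpace 𝕜 E] {c : ι → 𝕜} {g : ι → E} {f h : E} {M B : ℝ}
    (hrep : HasSum (fun j => c j • g j) f) (hsum : Summable fun j => ‖c j‖)
    (hM : ∑' j, ‖c j‖ ≤ M) (hB : 0 ≤ B) (hbound : ∀ j, ‖⟪h, g j⟫_𝕜‖ ≤ B) :
    ‖⟪h, f⟫_𝕜‖ ≤ M * B := by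
  have hinner : HasSum (fun j => ⟪h, c j • g j⟫_𝕜) ⟪h, f⟫_𝕜 := hrep.mapL (innerSL 𝕜 h)
  have hterm (j : ι) : ‖⟪h, c j • g j⟫_𝕜‖ ≤ ‖c j‖ * B := by
    rw [inner_smul_right, norm_mul]
    gcongr
    exact hbound j
  calc ‖⟪h, f⟫_𝕜‖ = ‖∑' j, ⟪h, c j • g j⟫_𝕜‖ := by rw [hinner.tsum_eq]
    _ ≤ (∑' j, ‖c j‖) * B := tsum_of_norm_bounded (hsum.hasSum.mul_right B) hterm
    _ ≤ M * B := by gcongr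

/-- A nonnegative sequence with `K * a (k + 1) ≤ K * a k - a k ^ 2` decays like `K / k`. -/
theorem natCast_mul_le_of_quadratic_decay {a : ℕ → ℝ} {K : ℝ} (hK : 0 < K)
    (ha : ∀ k, 0 ≤ a k) (hstep : ∀ k, K * a (k + 1) ≤ K * a k - a k ^ 2) (k : ℕ) :
    k * a k ≤ K := by
  induction k with
  | zero => simpa using hK.le
  | succ k ih =>
    have hquad : (k + 1) * (K * a k - a k ^ 2) ≤ K * K := by
      rcases Nat.eq_zero_or_pos k with rfl | hk
      · push_cast
        nlinarith [sq_nonneg (a 0 - K), sq_nonneg (a 0), sq_nonneg K]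
      · have hk' : (1 : ℝ) ≤ k := by exact_mod_cast hk
        have hle : a k ≤ K := (le_mul_of_one_le_left (ha k) hk').trans ih
        nlinarith [mul_nonneg (sub_nonneg.2 ih) (sub_nonneg.2 hle), sq_nonneg (a k)]
    have hmul := mul_le_mul_of_nonneg_left (hstep k) (by positivity : (0 : ℝ) ≤ k + 1)
    refine le_of_mul_le_mul_left ?_ hK
    push_cast
    linarith

/-- Convergence rate of the orthogonal greedy algorithm: if `f = ∑_j c_j g_j` with `g_j` in a
dictionary `D` of unit vectors and `∑_j |c_j| ≤ M`, and `(e_k)` is chosen greedily (each `e_k`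
maximizes `|⟨h_k, g⟩|` over `g ∈ D`, where `h_k = f - P_{k-1} f` and `p k = P_k f` is the
orthogonal projection of `f` onto the span of `e_0, …, e_{k-1}`), then
`‖f - P_m f‖ ≤ M m^{-1/2}` for every `m ≥ 1`. -/
theorem orthogonal_greedy_algorithm_rate
    {H : Type*} [NormedAddCommGroup H] [InnerProductSpace ℂ H] [CompleteSpace H]
    (D : Set H) (hD : ∀ g ∈ D, ‖g‖ = 1)
    (f : H) (M : ℝ) (c : ℕ → ℂ) (g : ℕ → H) (hg : ∀ j, g j ∈ D)
    (hrep : HasSum (fun j => c j • g j) f)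
    (hsum : Summable fun j => ‖c j‖) (hM : (∑' j, ‖c j‖) ≤ M)
    (e : ℕ → H) (he : ∀ k, e k ∈ D)
    (p : ℕ → H)
    (hmem : ∀ k, p k ∈ Submodule.span ℂ (Set.range fun i : Fin k => e i))
    (hperp : ∀ k, ∀ v ∈ Submodule.span ℂ (Set.range fun i : Fin k => e i),
      ⟪v, f - p k⟫_ℂ = 0)
    (hgreedy : ∀ k, ∀ x ∈ D, ‖⟪f - p k, x⟫_ℂ‖ ≤ ‖⟪f - p k, e k⟫_ℂ‖) :
    ∀ m : ℕ, 1 ≤ m → ‖f - p m‖ ≤ M / Real.sqrt m := by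
  have hM0 : 0 ≤ M := (tsum_nonneg fun j => norm_nonneg (c j)).trans hM
  have hdecr (k : ℕ) :
      ‖f - p (k + 1)‖ ^ 2 ≤ ‖f - p k‖ ^ 2 - ‖⟪f - p k, e k⟫_ℂ‖ ^ 2 := by
    have hspan : Submodule.span ℂ (Set.range fun i : Fin k => e i) ≤
        Submodule.span ℂ (Set.range fun i : Fin (k + 1) => e i) := by
      refine Submodule.span_mono ?_
      rintro _ ⟨i, rfl⟩
      exact ⟨i.castSucc, rfl⟩
    refine norm_sq_le_sub_norm_inner_sq (hD _ (he k)) (hperp (k + 1) _ ?_)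
      (hperp (k + 1) _ (Submodule.subset_span ⟨Fin.last k, rfl⟩))
    rw [sub_sub_sub_cancel_left]
    exact sub_mem (hmem (k + 1)) (hspan (hmem k))
  have hbound (k : ℕ) : ‖f - p k‖ ^ 2 ≤ M * ‖⟪f - p k, e k⟫_ℂ‖ := by
    have hself : ⟪f - p k, f⟫_ℂ = ⟪f - p k, f - p k⟫_ℂ := by
      rw [inner_sub_right _ f, inner_eq_zero_symm.mp (hperp k _ (hmem k)), sub_zero]
    have := norm_inner_le_of_hasSum hrep hsum hM (norm_nonneg _)
      fun j => hgreedy k (g j) (hg j)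
    rwa [hself, inner_self_eq_norm_sq_to_K, norm_pow, RCLike.norm_ofReal, abs_norm] at this
  intro m hm
  have hm' : (0 : ℝ) < m := by exact_mod_cast hm
  have hsq : m * ‖f - p m‖ ^ 2 ≤ M ^ 2 := by
    rcases hM0.eq_or_lt with rfl | hMpos
    · have hzero : ‖f - p m‖ ^ 2 = 0 := le_antisymm (by simpa using hbound m) (sq_nonneg _)
      simp [hzero]
    · refine natCast_mul_le_of_quadratic_decay (a := fun k => ‖f - p k‖ ^ 2) (pow_pos hMpos 2)
        (fun k => sq_nonneg _) (fun k => ?_) m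
      have hpow := pow_le_pow_left₀ (sq_nonneg _) (hbound k) 2
      have hmul := mul_le_mul_of_nonneg_left (hdecr k) (sq_nonneg M)
      linarith
  rw [le_div_iff₀ (Real.sqrt_pos.2 hm')]
  refine (pow_le_pow_iff_left₀ (by positivity) hM0 two_ne_zero).1 ?_
  rw [mul_pow, Real.sq_sqrt hm'.le]
  linarith
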